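/- arXiv:2405.07252 — 2 statements merged into one kernel-verified Lean document; each statement's English description precedes it below -/
import Mathlib

section
/- (Theorem 2, quantitative form) Suppose Θ = {P_φ : φ in G} for a nonempty subset G of F, let ε > 0, and suppose λ_0 := C_{c,N}(Φ)/ε < 1. Let Θ_ε = {φ in F : D_{c,N}(P_φ ‖ Θ) < ε}. Then C_{c,N}(Θ) ≤ R*_N(Θ, Φ) ≤ C_{c,N}(Θ_ε) + h(λ_0)/(1−λ_0), where C_{c,N}(Θ) and C_{c,N}(Θ_ε) denote the suprema of I_π(Y_N; Φ | Y^{N-1}) over priors π supported on G and on Θ_ε respectively, and h(λ) = −λ log λ − (1−λ) log(1−λ) is the binary entropy (with h(0) = h(1) = 0). -/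
noncomputable section

/-- A model: a strictly positive probability function on `Y^(n+1)`. -/
def IsModel {Y : Type*} [Fintype Y] {n : ℕ} (P : (Fin (n + 1) → Y) → ℝ) : Prop :=
  (∀ y, 0 < P y) ∧ (∑ y, P y) = 1

/-- A predictor: to every prefix `y^{N-1}` it assigns a strictly positive
probability function on `Y`. -/
def IsPredictor {Y : Type*} [Fintype Y] {n : ℕ} (Q : (Fin n → Y) → Y → ℝ) : Prop :=
  ∀ z, (∀ y, 0 < Q z y) ∧ (∑ y, Q z y) = 1

/-- Marginal probability `P(y^{N-1}) = Σ_y P(y^{N-1}, y)` of a prefix. -/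
def prefixProb {Y : Type*} [Fintype Y] {n : ℕ} (P : (Fin (n + 1) → Y) → ℝ)
    (z : Fin n → Y) : ℝ :=
  ∑ y : Y, P (Fin.snoc z y)

/-- Conditional probability `P(y_N | y^{N-1}) = P(y^N) / P(y^{N-1})`. -/
def condProb {Y : Type*} [Fintype Y] {n : ℕ} (P : (Fin (n + 1) → Y) → ℝ)
    (y : Fin (n + 1) → Y) : ℝ :=
  P y / prefixProb P (Fin.init y)

/-- The regret
`R_N(Pφ, Pθ, Q) = Σ_{y^N} Pφ(y^N) log( Pθ(y_N|y^{N-1}) / Q(y_N|y^{N-1}) )`. -/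
def regretN {Y : Type*} [Fintype Y] {n : ℕ} (Pφ Pθ : (Fin (n + 1) → Y) → ℝ)
    (Q : (Fin n → Y) → Y → ℝ) : ℝ :=
  ∑ y, Pφ y * Real.log (condProb Pθ y / Q (Fin.init y) (y (Fin.last n)))

/-- Conditional KL divergence of a model `P` from a predictor `Q`. -/
def DcPred {Y : Type*} [Fintype Y] {n : ℕ} (P : (Fin (n + 1) → Y) → ℝ)
    (Q : (Fin n → Y) → Y → ℝ) : ℝ :=
  ∑ y, P y * Real.log (condProb P y / Q (Fin.init y) (y (Fin.last n)))

/-- Conditional KL divergence of a model `P` from another model `P'`. -/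
def DcModel {Y : Type*} [Fintype Y] {n : ℕ} (P P' : (Fin (n + 1) → Y) → ℝ) : ℝ :=
  ∑ y, P y * Real.log (condProb P y / condProb P' y)

/-- A prior: a probability vector on the index set `F`. -/
def IsPrior {F : Type*} [Fintype F] (π : F → ℝ) : Prop :=
  (∀ φ, 0 ≤ π φ) ∧ (∑ φ, π φ) = 1

/-- Conditional divergence of a model from the hypothesis class
`Θ = {P θ : θ ∈ G}`: the minimum over `θ ∈ G` of `D_{c,N}(P ‖ P θ)`. -/
def DcSet {Y F : Type*} [Fintype Y] [Fintype F] {n : ℕ}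
    (P : F → (Fin (n + 1) → Y) → ℝ) (G : Finset F) (hG : G.Nonempty)
    (Pφ : (Fin (n + 1) → Y) → ℝ) : ℝ :=
  G.inf' hG fun θ => DcModel Pφ (P θ)

/-- The mixture predictor
`Q_π(y_N | y^{N-1}) = (Σ_φ π(φ) P_φ(y^N)) / (Σ_φ π(φ) P_φ(y^{N-1}))`. -/
def mixPred {Y F : Type*} [Fintype Y] [Fintype F] {n : ℕ}
    (P : F → (Fin (n + 1) → Y) → ℝ) (π : F → ℝ) : (Fin n → Y) → Y → ℝ :=
  fun z y => (∑ φ, π φ * P φ (Fin.snoc z y)) / (∑ φ, π φ * prefixProb (P φ) z)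

/-- `I_π(Y_N; Φ | Y^{N-1})`. -/
def mutualInfoN {Y F : Type*} [Fintype Y] [Fintype F] {n : ℕ}
    (P : F → (Fin (n + 1) → Y) → ℝ) (π : F → ℝ) : ℝ :=
  ∑ φ, ∑ y, π φ * P φ y *
    Real.log (condProb (P φ) y / mixPred P π (Fin.init y) (y (Fin.last n)))

/-- `J(π) = I_π(Y_N; Φ | Y^{N-1}) − Σ_φ π(φ) D_{c,N}(P_φ ‖ Θ)`. -/
def Jfun {Y F : Type*} [Fintype Y] [Fintype F] {n : ℕ}
    (P : F → (Fin (n + 1) → Y) → ℝ) (G : Finset F) (hG : G.Nonempty)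
    (π : F → ℝ) : ℝ :=
  mutualInfoN P π - ∑ φ, π φ * DcSet P G hG (P φ)

/-- The min-max regret
`R*_N(Θ, Φ) = inf_Q max_{φ ∈ F} max_{θ ∈ G} R_N(P_φ, P_θ, Q)`. -/
def Rstar {Y F : Type*} [Fintype Y] [Fintype F] [Nonempty F] {n : ℕ}
    (P : F → (Fin (n + 1) → Y) → ℝ) (G : Finset F) (hG : G.Nonempty) : ℝ :=
  sInf {r : ℝ | ∃ Q, IsPredictor Q ∧
    r = Finset.univ.sup' Finset.univ_nonempty fun φ =>
          G.sup' hG fun θ => regretN (P φ) (P θ) Q}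

/-- The conditional capacity `C_{c,N}(Φ) = sup_π I_π(Y_N; Φ | Y^{N-1})`. -/
def capacityN {Y F : Type*} [Fintype Y] [Fintype F] {n : ℕ}
    (P : F → (Fin (n + 1) → Y) → ℝ) : ℝ :=
  sSup {r : ℝ | ∃ π, IsPrior π ∧ r = mutualInfoN P π}

/-- The binary entropy `h(λ) = −λ log λ − (1−λ) log(1−λ)`
(with `h(0) = h(1) = 0`, using `Real.log 0 = 0`). -/
def binEnt (l : ℝ) : ℝ := -(l * Real.log l) - (1 - l) * Real.log (1 - l)

section Helpers

variable {Y F : Type*} [Fintype Y] [Fintype F] {n : ℕ}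

/-- The mixture `Σ_φ π(φ) P_φ` of the family. -/
def mixture (P : F → (Fin (n + 1) → Y) → ℝ) (π : F → ℝ) (y : Fin (n + 1) → Y) : ℝ :=
  ∑ φ, π φ * P φ y

/-- The predictor given by the conditional probabilities of a model. -/
def condPred (P : (Fin (n + 1) → Y) → ℝ) (z : Fin n → Y) (y : Y) : ℝ :=
  condProb P (Fin.snoc z y)

lemma sum_snoc (f : (Fin (n + 1) → Y) → ℝ) :
    ∑ y, f y = ∑ z : Fin n → Y, ∑ a : Y, f (Fin.snoc z a) := by
  rw [← (Fin.snocEquiv fun _ => Y).sum_comp f, Fintype.sum_prod_type, Finset.sum_comm]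
  rfl

lemma sum_mul_init (P : (Fin (n + 1) → Y) → ℝ) (g : (Fin n → Y) → ℝ) :
    ∑ y, P y * g (Fin.init y) = ∑ z, prefixProb P z * g z := by
  rw [sum_snoc]
  refine Finset.sum_congr rfl fun z _ => ?_
  simp [prefixProb, Finset.sum_mul]

lemma sum_prefixProb (P : (Fin (n + 1) → Y) → ℝ) : ∑ z, prefixProb P z = ∑ y, P y :=
  (sum_snoc P).symm

lemma IsModel.nonempty {P : (Fin (n + 1) → Y) → ℝ} (hP : IsModel P) : Nonempty Y := by
  by_contra h
  rw [not_nonempty_iff] at h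
  simpa using hP.2

lemma IsModel.prefixProb_pos {P : (Fin (n + 1) → Y) → ℝ} (hP : IsModel P) (z : Fin n → Y) :
    0 < prefixProb P z :=
  have := hP.nonempty
  Finset.sum_pos (fun _ _ => hP.1 _) Finset.univ_nonempty

lemma IsModel.condProb_pos {P : (Fin (n + 1) → Y) → ℝ} (hP : IsModel P)
    (y : Fin (n + 1) → Y) : 0 < condProb P y :=
  div_pos (hP.1 y) (hP.prefixProb_pos _)

lemma IsModel.isPredictor_condPred {P : (Fin (n + 1) → Y) → ℝ} (hP : IsModel P) :
    IsPredictor (condPred P) := by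
  refine fun z => ⟨fun y => hP.condProb_pos _, ?_⟩
  simp only [condPred, condProb, Fin.init_snoc]
  rw [← Finset.sum_div]
  exact div_self (hP.prefixProb_pos z).ne'

lemma DcPred_condPred (P P' : (Fin (n + 1) → Y) → ℝ) :
    DcPred P (condPred P') = DcModel P P' := by
  simp [DcPred, DcModel, condPred, Fin.snoc_init_self]

lemma prefixProb_mixture (P : F → (Fin (n + 1) → Y) → ℝ) (π : F → ℝ) (z : Fin n → Y) :
    prefixProb (mixture P π) z = ∑ φ, π φ * prefixProb (P φ) z := by
  simp only [prefixProb, mixture, Finset.mul_sum]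
  exact Finset.sum_comm

lemma mixPred_eq_condPred (P : F → (Fin (n + 1) → Y) → ℝ) (π : F → ℝ) :
    mixPred P π = condPred (mixture P π) := by
  funext z y
  simp only [mixPred, condPred, condProb, Fin.init_snoc, prefixProb_mixture]
  rfl

lemma mutualInfoN_eq_sum (P : F → (Fin (n + 1) → Y) → ℝ) (π : F → ℝ) :
    mutualInfoN P π = ∑ φ, π φ * DcModel (P φ) (mixture P π) := by
  simp only [← DcPred_condPred, ← mixPred_eq_condPred, mutualInfoN, DcPred, Finset.mul_sum,
    mul_assoc]

lemma IsPrior.exists_pos {π : F → ℝ} (hπ : IsPrior π) : ∃ φ, 0 < π φ := by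
  by_contra! h
  have := Finset.sum_nonpos fun φ (_ : φ ∈ Finset.univ) => h φ
  linarith [hπ.2]

lemma IsPrior.isModel_mixture {P : F → (Fin (n + 1) → Y) → ℝ} (hP : ∀ φ, IsModel (P φ))
    {π : F → ℝ} (hπ : IsPrior π) : IsModel (mixture P π) := by
  refine ⟨fun y => ?_, ?_⟩
  · obtain ⟨φ, hφ⟩ := hπ.exists_pos
    exact Finset.sum_pos' (fun ψ _ => mul_nonneg (hπ.1 ψ) ((hP ψ).1 y).le)
      ⟨φ, Finset.mem_univ φ, mul_pos hφ ((hP φ).1 y)⟩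
  · simp only [mixture]
    rw [Finset.sum_comm]
    simp [← Finset.mul_sum, (hP _).2, hπ.2]

lemma isPrior_single [DecidableEq F] (φ : F) : IsPrior (Pi.single φ (1 : ℝ)) :=
  ⟨fun ψ => (Pi.single_nonneg.2 zero_le_one : (0 : F → ℝ) ≤ Pi.single φ 1) ψ, by simp⟩

lemma DcPred_nonneg {P : (Fin (n + 1) → Y) → ℝ} (hP : IsModel P) {Q : (Fin n → Y) → Y → ℝ}
    (hQ : IsPredictor Q) : 0 ≤ DcPred P Q := by
  have hsum : ∑ y : Fin (n + 1) → Y,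
      prefixProb P (Fin.init y) * Q (Fin.init y) (y (Fin.last n)) = 1 := by
    rw [sum_snoc]
    simp [← Finset.mul_sum, (hQ _).2, sum_prefixProb, hP.2]
  calc (0 : ℝ) = ∑ y, (P y - prefixProb P (Fin.init y) * Q (Fin.init y) (y (Fin.last n))) := by
        rw [Finset.sum_sub_distrib, hP.2, hsum, sub_self]
    _ ≤ DcPred P Q := Finset.sum_le_sum fun y _ => by
        have hp := hP.1 y
        have hz := hP.prefixProb_pos (Fin.init y)
        have hq := (hQ (Fin.init y)).1 (y (Fin.last n))
        have h := Real.one_sub_inv_le_log_of_pos (div_pos (hP.condProb_pos y) hq)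
        refine le_trans (le_of_eq ?_) (mul_le_mul_of_nonneg_left h hp.le)
        rw [condProb]
        field_simp

lemma DcModel_nonneg {P P' : (Fin (n + 1) → Y) → ℝ} (hP : IsModel P) (hP' : IsModel P') :
    0 ≤ DcModel P P' :=
  DcPred_condPred P P' ▸ DcPred_nonneg hP hP'.isPredictor_condPred

lemma DcModel_self {P : (Fin (n + 1) → Y) → ℝ} (hP : IsModel P) : DcModel P P = 0 :=
  Finset.sum_eq_zero fun y _ => by rw [div_self (hP.condProb_pos y).ne', Real.log_one, mul_zero]

/-- A model dominated, up to a factor `s`, by another one has small divergence from it. -/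
lemma DcModel_le_neg_log {P P' : (Fin (n + 1) → Y) → ℝ} (hP : IsModel P) (hP' : IsModel P')
    {s : ℝ} (hs : 0 < s) (h : ∀ y, s * P y ≤ P' y) : DcModel P P' ≤ -Real.log s := by
  have hsum : ∑ y, P y * (prefixProb P' (Fin.init y) / prefixProb P (Fin.init y) - 1) = 0 := by
    simp only [mul_sub, mul_one]
    rw [Finset.sum_sub_distrib, hP.2,
      sum_mul_init P fun z => prefixProb P' z / prefixProb P z]
    simp_rw [mul_div_cancel₀ _ (hP.prefixProb_pos _).ne']
    rw [sum_prefixProb, hP'.2, sub_self]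
  calc DcModel P P'
      ≤ ∑ y, (P y * (prefixProb P' (Fin.init y) / prefixProb P (Fin.init y) - 1)
          + P y * -Real.log s) := Finset.sum_le_sum fun y _ => by
        have hp := hP.1 y
        have hp' := hP'.1 y
        have hz := hP.prefixProb_pos (Fin.init y)
        have hz' := hP'.prefixProb_pos (Fin.init y)
        rw [← mul_add]
        refine mul_le_mul_of_nonneg_left ?_ hp.le
        have hle : condProb P y / condProb P' y
            ≤ prefixProb P' (Fin.init y) / prefixProb P (Fin.init y) / s := by
          rw [condProb, condProb, div_div_div_eq, div_div, div_le_div_iff₀ (by positivity)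
            (by positivity)]
          have := mul_le_mul_of_nonneg_right (h y) (mul_pos hz hz').le
          linarith
        have hlog := Real.log_le_log (div_pos (hP.condProb_pos y) (hP'.condProb_pos y)) hle
        rw [Real.log_div (div_pos hz' hz).ne' hs.ne'] at hlog
        linarith [Real.log_le_sub_one_of_pos (div_pos hz' hz)]
    _ = -Real.log s := by
        rw [Finset.sum_add_distrib, hsum, zero_add, ← Finset.sum_mul, hP.2, one_mul]

lemma regretN_eq {P P' : (Fin (n + 1) → Y) → ℝ} (hP : IsModel P) (hP' : IsModel P')
    {Q : (Fin n → Y) → Y → ℝ} (hQ : IsPredictor Q) :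
    regretN P P' Q = DcPred P Q - DcModel P P' := by
  simp only [regretN, DcPred, DcModel]
  rw [← Finset.sum_sub_distrib]
  refine Finset.sum_congr rfl fun y _ => ?_
  have hq := ((hQ (Fin.init y)).1 (y (Fin.last n))).ne'
  rw [Real.log_div (hP'.condProb_pos y).ne' hq, Real.log_div (hP.condProb_pos y).ne' hq,
    Real.log_div (hP.condProb_pos y).ne' (hP'.condProb_pos y).ne']
  ring

/-- The compensation identity: the average divergence from a predictor splits at the mixture. -/
lemma sum_mul_DcPred {P : F → (Fin (n + 1) → Y) → ℝ} (hP : ∀ φ, IsModel (P φ)) {π : F → ℝ}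
    (hπ : IsPrior π) {Q : (Fin n → Y) → Y → ℝ} (hQ : IsPredictor Q) :
    ∑ φ, π φ * DcPred (P φ) Q = mutualInfoN P π + DcPred (mixture P π) Q := by
  have hM := hπ.isModel_mixture hP
  have hmix : DcPred (mixture P π) Q = ∑ φ, π φ * regretN (P φ) (mixture P π) Q := by
    simp only [DcPred, regretN, Finset.mul_sum, ← mul_assoc]
    rw [Finset.sum_comm]
    exact Finset.sum_congr rfl fun y _ => by rw [← Finset.sum_mul]; rfl
  rw [hmix, mutualInfoN_eq_sum, ← Finset.sum_add_distrib]
  refine Finset.sum_congr rfl fun φ _ => ?_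
  rw [regretN_eq (hP φ) hM hQ]
  ring

lemma mutualInfoN_le_sum_mul_DcPred {P : F → (Fin (n + 1) → Y) → ℝ} (hP : ∀ φ, IsModel (P φ))
    {π : F → ℝ} (hπ : IsPrior π) {Q : (Fin n → Y) → Y → ℝ} (hQ : IsPredictor Q) :
    mutualInfoN P π ≤ ∑ φ, π φ * DcPred (P φ) Q := by
  linarith [sum_mul_DcPred hP hπ hQ, DcPred_nonneg (hπ.isModel_mixture hP) hQ]

lemma isCompact_setOf_isPrior : IsCompact {π : F → ℝ | IsPrior π} :=
  isCompact_stdSimplex ℝ F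

lemma continuousOn_DcModel_mixture {P : F → (Fin (n + 1) → Y) → ℝ} (hP : ∀ φ, IsModel (P φ))
    {P₀ : (Fin (n + 1) → Y) → ℝ} (hP₀ : IsModel P₀) :
    ContinuousOn (fun π => DcModel P₀ (mixture P π)) {π : F → ℝ | IsPrior π} := by
  have hcond (y : Fin (n + 1) → Y) :
      ContinuousOn (fun π => condProb (mixture P π) y) {π : F → ℝ | IsPrior π} := by
    refine ContinuousOn.div ?_ ?_ fun π hπ => ((hπ.isModel_mixture hP).prefixProb_pos _).ne'
    · simp only [mixture]
      fun_prop
    · simp only [prefixProb, mixture]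
      fun_prop
  refine continuousOn_finsetSum _ fun y _ => continuousOn_const.mul ?_
  exact (continuousOn_const.div (hcond y) fun π hπ =>
    ((hπ.isModel_mixture hP).condProb_pos y).ne').log fun π hπ =>
      (div_pos (hP₀.condProb_pos y) ((hπ.isModel_mixture hP).condProb_pos y)).ne'

lemma continuousOn_mutualInfoN {P : F → (Fin (n + 1) → Y) → ℝ} (hP : ∀ φ, IsModel (P φ)) :
    ContinuousOn (mutualInfoN P) {π : F → ℝ | IsPrior π} := by
  rw [funext (mutualInfoN_eq_sum P)]
  exact continuousOn_finsetSum _ fun φ _ =>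
    (continuous_apply φ).continuousOn.mul (continuousOn_DcModel_mixture hP (hP φ))

lemma bddAbove_mutualInfoN {P : F → (Fin (n + 1) → Y) → ℝ} (hP : ∀ φ, IsModel (P φ)) :
    BddAbove {r : ℝ | ∃ π, IsPrior π ∧ r = mutualInfoN P π} := by
  refine (isCompact_setOf_isPrior.bddAbove_image (continuousOn_mutualInfoN hP)).mono ?_
  rintro _ ⟨π, hπ, rfl⟩
  exact ⟨π, hπ, rfl⟩

/-- A prior maximizing the penalized information `I_π - Σ_φ π(φ) d(φ)` equalizes the penalized
divergences from above. -/
lemma exists_isPrior_equalizing [Nonempty F] {P : F → (Fin (n + 1) → Y) → ℝ}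
    (hP : ∀ φ, IsModel (P φ)) (d : F → ℝ) :
    ∃ π, IsPrior π ∧
      (∀ π', IsPrior π' →
        mutualInfoN P π' - ∑ φ, π' φ * d φ ≤ mutualInfoN P π - ∑ φ, π φ * d φ) ∧
      ∀ φ, DcModel (P φ) (mixture P π) - d φ ≤ mutualInfoN P π - ∑ φ, π φ * d φ := by
  classical
  have hne : {π : F → ℝ | IsPrior π}.Nonempty := ⟨_, isPrior_single (Classical.arbitrary F)⟩
  obtain ⟨π, hπ, hmax⟩ := isCompact_setOf_isPrior.exists_isMaxOn hne
    ((continuousOn_mutualInfoN hP).sub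
      (g := fun π => ∑ φ, π φ * d φ) (by fun_prop))
  refine ⟨π, hπ, fun π' hπ' => hmax hπ', fun φ => ?_⟩
  set J := mutualInfoN P π - ∑ φ, π φ * d φ with hJ
  let γ : ℝ → F → ℝ := fun t => (1 - t) • π + t • Pi.single φ 1
  have hγ {t : ℝ} (ht : t ∈ Set.Icc (0 : ℝ) 1) : IsPrior (γ t) :=
    convex_stdSimplex ℝ F hπ (isPrior_single φ) (sub_nonneg.2 ht.2) ht.1 (by ring)
  have hle {t : ℝ} (ht : t ∈ Set.Ioc (0 : ℝ) 1) :
      DcModel (P φ) (mixture P (γ t)) - d φ ≤ J := by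
    have ht' : t ∈ Set.Icc (0 : ℝ) 1 := ⟨ht.1.le, ht.2⟩
    have hmix := (hγ ht').isModel_mixture hP
    have h1 : mutualInfoN P (γ t) - ∑ ψ, γ t ψ * d ψ ≤ J := hmax (hγ ht')
    have h2 := mutualInfoN_le_sum_mul_DcPred hP hπ hmix.isPredictor_condPred
    simp only [DcPred_condPred] at h2
    have hsplit (g : F → ℝ) : ∑ ψ, γ t ψ * g ψ = (1 - t) * ∑ ψ, π ψ * g ψ + t * g φ := by
      simp only [γ, Pi.add_apply, Pi.smul_apply, smul_eq_mul, add_mul, Finset.sum_add_distrib,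
        mul_assoc, Finset.mul_sum]
      simp [Pi.single_apply]
    rw [mutualInfoN_eq_sum, hsplit, hsplit] at h1
    have h3 := mul_le_mul_of_nonneg_left h2 (sub_nonneg.2 ht.2)
    have h4 : t * (DcModel (P φ) (mixture P (γ t)) - d φ) ≤ t * J := by
      rw [hJ] at h1 ⊢
      linarith
    exact le_of_mul_le_mul_left h4 ht.1
  have hcont : ContinuousOn (fun t => DcModel (P φ) (mixture P (γ t)) - d φ)
      (Set.Icc (0 : ℝ) 1) :=
    ((continuousOn_DcModel_mixture hP (hP φ)).comp (by fun_prop) fun t ht => hγ ht).sub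
      continuousOn_const
  have hcl : (0 : ℝ) ∈ closure (Set.Ioc (0 : ℝ) 1) := by
    rw [closure_Ioc zero_ne_one]
    simp
  have hlim : Filter.Tendsto (fun t => DcModel (P φ) (mixture P (γ t)) - d φ)
      (nhdsWithin 0 (Set.Ioc (0 : ℝ) 1)) (nhds (DcModel (P φ) (mixture P (γ 0)) - d φ)) :=
    (hcont 0 (by simp)).mono_left (nhdsWithin_mono _ Set.Ioc_subset_Icc_self)
  have : (nhdsWithin 0 (Set.Ioc (0 : ℝ) 1)).NeBot := mem_closure_iff_nhdsWithin_neBot.1 hcl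
  have h0 := le_of_tendsto hlim (Filter.eventually_of_mem self_mem_nhdsWithin fun t ht => hle ht)
  simpa [γ] using h0

/-- Restricting a prior to a set of mass `s` costs at most `-log s` in the average divergence
from the mixture. -/
lemma sum_filter_mul_DcModel_le {P : F → (Fin (n + 1) → Y) → ℝ} (hP : ∀ φ, IsModel (P φ))
    {π : F → ℝ} (hπ : IsPrior π) (A : Finset F) (hA : 0 < ∑ φ ∈ A, π φ) :
    ∃ π', IsPrior π' ∧ (∀ φ ∉ A, π' φ = 0) ∧
      ∑ φ ∈ A, π φ * DcModel (P φ) (mixture P π) ≤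
        (∑ φ ∈ A, π φ) * (mutualInfoN P π' - Real.log (∑ φ ∈ A, π φ)) := by
  classical
  set s := ∑ φ ∈ A, π φ with hs
  let π' : F → ℝ := fun φ => if φ ∈ A then π φ / s else 0
  have hπ' : IsPrior π' := by
    refine ⟨fun φ => ?_, ?_⟩
    · simp only [π']
      split_ifs
      exacts [div_nonneg (hπ.1 φ) hA.le, le_rfl]
    · simp [π', ← Finset.sum_div, ← hs, hA.ne']
  have hM := hπ.isModel_mixture hP
  have hmul (φ : F) : s * π' φ = if φ ∈ A then π φ else 0 := by
    simp only [π', mul_ite, mul_zero, mul_div_cancel₀ _ hA.ne']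
  have hdom (y : Fin (n + 1) → Y) : s * mixture P π' y ≤ mixture P π y := by
    simp only [mixture, Finset.mul_sum, ← mul_assoc, hmul]
    refine Finset.sum_le_sum fun φ _ => mul_le_mul_of_nonneg_right ?_ ((hP φ).1 y).le
    split_ifs
    exacts [le_rfl, hπ.1 φ]
  refine ⟨π', hπ', fun φ hφ => by simp [π', hφ], ?_⟩
  have hsplit := sum_mul_DcPred hP hπ' hM.isPredictor_condPred
  simp only [DcPred_condPred] at hsplit
  calc ∑ φ ∈ A, π φ * DcModel (P φ) (mixture P π)
      = s * ∑ φ, π' φ * DcModel (P φ) (mixture P π) := by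
        simp [Finset.mul_sum, ← mul_assoc, hmul]
    _ ≤ s * (mutualInfoN P π' - Real.log s) := by
        refine mul_le_mul_of_nonneg_left ?_ hA.le
        linarith [DcModel_le_neg_log (hπ'.isModel_mixture hP) hM hA hdom]

lemma DcSet_nonneg {P : F → (Fin (n + 1) → Y) → ℝ} (hP : ∀ φ, IsModel (P φ)) (G : Finset F)
    (hG : G.Nonempty) (φ : F) : 0 ≤ DcSet P G hG (P φ) :=
  Finset.le_inf' _ _ fun θ _ => DcModel_nonneg (hP φ) (hP θ)

lemma DcSet_eq_zero {P : F → (Fin (n + 1) → Y) → ℝ} (hP : ∀ φ, IsModel (P φ)) {G : Finset F}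
    (hG : G.Nonempty) {θ : F} (hθ : θ ∈ G) : DcSet P G hG (P θ) = 0 :=
  le_antisymm
    ((Finset.inf'_le (fun θ' => DcModel (P θ) (P θ')) hθ).trans_eq (DcModel_self (hP θ)))
    (DcSet_nonneg hP G hG θ)

lemma sup'_regretN_eq {P : F → (Fin (n + 1) → Y) → ℝ} (hP : ∀ φ, IsModel (P φ)) (G : Finset F)
    (hG : G.Nonempty) (φ : F) {Q : (Fin n → Y) → Y → ℝ} (hQ : IsPredictor Q) :
    (G.sup' hG fun θ => regretN (P φ) (P θ) Q) = DcPred (P φ) Q - DcSet P G hG (P φ) := by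
  refine le_antisymm (Finset.sup'_le _ _ fun θ hθ => ?_) ?_
  · rw [regretN_eq (hP φ) (hP θ) hQ]
    exact sub_le_sub_left (Finset.inf'_le (fun θ => DcModel (P φ) (P θ)) hθ) _
  · obtain ⟨θ, hθ, h⟩ := G.exists_mem_eq_inf' hG fun θ => DcModel (P φ) (P θ)
    rw [DcSet.eq_def, h, ← regretN_eq (hP φ) (hP θ) hQ]
    exact Finset.le_sup' (fun θ => regretN (P φ) (P θ) Q) hθ

lemma mutualInfoN_le_maxRegret [Nonempty F] {P : F → (Fin (n + 1) → Y) → ℝ}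
    (hP : ∀ φ, IsModel (P φ)) {G : Finset F} (hG : G.Nonempty) {π : F → ℝ} (hπ : IsPrior π)
    (hπG : ∀ φ ∉ G, π φ = 0) {Q : (Fin n → Y) → Y → ℝ} (hQ : IsPredictor Q) :
    mutualInfoN P π ≤ Finset.univ.sup' Finset.univ_nonempty fun φ =>
      G.sup' hG fun θ => regretN (P φ) (P θ) Q := by
  set R := Finset.univ.sup' Finset.univ_nonempty fun φ =>
    G.sup' hG fun θ => regretN (P φ) (P θ) Q
  calc mutualInfoN P π ≤ ∑ φ, π φ * DcPred (P φ) Q := mutualInfoN_le_sum_mul_DcPred hP hπ hQ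
    _ ≤ ∑ φ, π φ * R := Finset.sum_le_sum fun φ _ => by
        by_cases hφ : φ ∈ G
        · refine mul_le_mul_of_nonneg_left ?_ (hπ.1 φ)
          have h := sup'_regretN_eq hP G hG φ hQ
          rw [DcSet_eq_zero hP hG hφ, sub_zero] at h
          rw [← h]
          exact Finset.le_sup' (fun φ => G.sup' hG fun θ => regretN (P φ) (P θ) Q)
            (Finset.mem_univ φ)
        · simp [hπG φ hφ]
    _ = R := by rw [← Finset.sum_mul, hπ.2, one_mul]

lemma neg_log_one_sub_le {x : ℝ} (h0 : 0 ≤ x) (h1 : x < 1) :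
    -Real.log (1 - x) ≤ binEnt x / (1 - x) := by
  rw [le_div_iff₀ (sub_pos.2 h1), binEnt]
  nlinarith [Real.mul_log_nonpos h0 h1.le]

end Helpers

variable {Y F : Type*} [Fintype Y] [Nonempty Y] [Fintype F] [Nonempty F] {n : ℕ}

/-- Theorem 2, quantitative form:
`C_{c,N}(Θ) ≤ R*_N(Θ, Φ) ≤ C_{c,N}(Θ_ε) + h(λ_0)/(1−λ_0)` with
`λ_0 = C_{c,N}(Φ)/ε < 1`, where the capacities of `Θ` resp. `Θ_ε` are the
suprema of `I_π` over priors supported on `G` resp. on `Θ_ε`. -/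
theorem Rstar_sandwich
    (P : F → (Fin (n + 1) → Y) → ℝ) (hP : ∀ φ, IsModel (P φ))
    (G : Finset F) (hG : G.Nonempty)
    (ε : ℝ) (hε : 0 < ε) (hl : capacityN P / ε < 1) :
    sSup {r : ℝ | ∃ π, IsPrior π ∧ (∀ φ ∉ G, π φ = 0) ∧ r = mutualInfoN P π} ≤
        Rstar P G hG ∧
    Rstar P G hG ≤
      sSup {r : ℝ | ∃ π, IsPrior π ∧
          (∀ φ ∉ Finset.univ.filter (fun φ => DcSet P G hG (P φ) < ε), π φ = 0) ∧
          r = mutualInfoN P π} +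
        binEnt (capacityN P / ε) / (1 - capacityN P / ε) := by
  classical
  obtain ⟨θ₀, hθ₀⟩ := id hG
  have hsingle : ∀ φ ∉ G, (Pi.single θ₀ 1 : F → ℝ) φ = 0 := fun φ hφ =>
    Pi.single_eq_of_ne (ne_of_mem_of_not_mem hθ₀ hφ).symm 1
  refine ⟨csSup_le ⟨_, _, isPrior_single θ₀, hsingle, rfl⟩ ?_, ?_⟩
  · rintro _ ⟨π, hπ, hπG, rfl⟩
    refine le_csInf ⟨_, _, (hP θ₀).isPredictor_condPred, rfl⟩ ?_
    rintro _ ⟨Q, hQ, rfl⟩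
    exact mutualInfoN_le_maxRegret hP _ hπ hπG hQ
  set d : F → ℝ := fun φ => DcSet P G hG (P φ) with hd
  set A := Finset.univ.filter fun φ => d φ < ε with hAdef
  set C := capacityN P
  obtain ⟨π, hπ, hmax, hle⟩ := exists_isPrior_equalizing hP d
  set J := mutualInfoN P π - ∑ φ, π φ * d φ with hJ
  have hM := hπ.isModel_mixture hP
  have hRstar : Rstar P G hG ≤ J := by
    refine le_trans (csInf_le ⟨mutualInfoN P (Pi.single θ₀ 1), ?_⟩
      ⟨_, hM.isPredictor_condPred, rfl⟩) ?_
    · rintro _ ⟨Q, hQ, rfl⟩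
      exact mutualInfoN_le_maxRegret hP _ (isPrior_single θ₀) hsingle hQ
    · refine Finset.sup'_le _ _ fun φ _ => ?_
      rw [sup'_regretN_eq hP G _ φ hM.isPredictor_condPred, DcPred_condPred]
      exact hle φ
  have hJ0 : 0 ≤ J := by
    refine le_trans (sub_nonneg.2 ?_) (hmax _ (isPrior_single θ₀))
    have h1 : ∑ φ, (Pi.single θ₀ 1 : F → ℝ) φ * d φ = 0 := by
      simp [Pi.single_apply, hd, DcSet_eq_zero hP hG hθ₀]
    rw [h1, mutualInfoN_eq_sum]
    exact Finset.sum_nonneg fun φ _ => mul_nonneg ((isPrior_single θ₀).1 φ)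
      (DcModel_nonneg (hP φ) ((isPrior_single θ₀).isModel_mixture hP))
  have hd0 (φ : F) : 0 ≤ d φ := DcSet_nonneg hP G _ φ
  have hcap : mutualInfoN P π ≤ C := le_csSup (bddAbove_mutualInfoN hP) ⟨π, hπ, rfl⟩
  have hC0 : 0 ≤ C / ε := by
    refine div_nonneg (hJ0.trans (le_trans ?_ hcap)) hε.le
    exact sub_le_self _ (Finset.sum_nonneg fun φ _ => mul_nonneg (hπ.1 φ) (hd0 φ))
  set s := ∑ φ ∈ A, π φ with hs
  have hpen : (1 - s) * ε ≤ ∑ φ, π φ * d φ := by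
    calc (1 - s) * ε = ∑ φ, (if φ ∈ A then 0 else π φ * ε) := by
          rw [← hπ.2, hs, ← Finset.sum_filter_add_sum_filter_not Finset.univ (· ∈ A) π]
          simp [Finset.sum_ite, Finset.sum_mul]
      _ ≤ ∑ φ, π φ * d φ := Finset.sum_le_sum fun φ _ => by
          split_ifs with hφ
          · exact mul_nonneg (hπ.1 φ) (hd0 φ)
          · exact mul_le_mul_of_nonneg_left (by simpa [hAdef] using hφ) (hπ.1 φ)
  have hmass : 1 - C / ε ≤ s := by
    have : 1 - s ≤ C / ε := by
      rw [le_div_iff₀ hε]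
      linarith
    linarith
  have hs0 : 0 < s := (sub_pos.2 hl).trans_le hmass
  obtain ⟨π', hπ', hπ'A, hle'⟩ := sum_filter_mul_DcModel_le hP hπ A hs0
  have hslack (φ : F) : π φ * J = π φ * (DcModel (P φ) (mixture P π) - d φ) := by
    have hsum : ∑ ψ, π ψ * (J - (DcModel (P ψ) (mixture P π) - d ψ)) = 0 := by
      simp only [mul_sub, Finset.sum_sub_distrib]
      rw [← Finset.sum_mul, hπ.2, ← mutualInfoN_eq_sum, hJ]
      ring
    have h := (Finset.sum_eq_zero_iff_of_nonneg fun ψ _ =>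
      mul_nonneg (hπ.1 ψ) (sub_nonneg.2 (hle ψ))).1 hsum φ (Finset.mem_univ φ)
    linarith
  have hJle : J ≤ mutualInfoN P π' - Real.log s := by
    refine le_of_mul_le_mul_left (le_trans ?_ hle') hs0
    rw [Finset.sum_mul]
    refine Finset.sum_le_sum fun φ _ => ?_
    rw [hslack]
    exact mul_le_mul_of_nonneg_left (sub_le_self _ (hd0 φ)) (hπ.1 φ)
  have hcapA : mutualInfoN P π' ≤
      sSup {r : ℝ | ∃ π, IsPrior π ∧ (∀ φ ∉ A, π φ = 0) ∧ r = mutualInfoN P π} :=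
    le_csSup ((bddAbove_mutualInfoN hP).mono (by rintro r ⟨π, h, _, hr⟩; exact ⟨π, h, hr⟩))
      ⟨π', hπ', hπ'A, rfl⟩
  have hlog := Real.log_le_log (sub_pos.2 hl) hmass
  have hent := neg_log_one_sub_le hC0 hl
  refine hRstar.trans (hJle.trans ?_)
  linarith
end
end

section
/- (Theorem 4) The combined batch-and-online min-max regret equals the maximum over priors of the normalized difference between the block conditional mutual information and the average divergence to the hypothesis class: R*_{N,L}(Θ, Φ) = max over priors π on F of (1/L) ( I_π(Y^L; Φ | Y^N) − Σ_φ π(φ) D_{c,N,L}(P_φ ‖ Θ) ); moreover, for each prior π the infimum over L-predictors of Σ_φ π(φ) ( D_{c,N,L}(P_φ ‖ Q) − D_{c,N,L}(P_φ ‖ Θ) ) is attained at the mixture L-predictor Q_π. -/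
/-!
Combined batch-and-online setting: sequences of length `N + L` over a nonempty
finite alphabet `Y` are encoded as pairs `(y^N, y^L) : (Fin N → Y) × (Fin L → Y)`
of the first `N` coordinates and the last `L` coordinates.
-/

noncomputable section

/-- A model: a strictly positive probability function on `Y^(N+L)`. -/
def IsModelNL {Y : Type*} [Fintype Y] {N L : ℕ}
    (P : (Fin N → Y) × (Fin L → Y) → ℝ) : Prop :=
  (∀ y, 0 < P y) ∧ (∑ y, P y) = 1

/-- An `L`-predictor: to every `y^N` it assigns a strictly positive probability
function on `Y^L`. -/
def IsLPredictor {Y : Type*} [Fintype Y] {N L : ℕ}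
    (Q : (Fin N → Y) → (Fin L → Y) → ℝ) : Prop :=
  ∀ z, (∀ w, 0 < Q z w) ∧ (∑ w, Q z w) = 1

/-- Marginal probability `P(y^N)` of the first `N` coordinates. -/
def margNL {Y : Type*} [Fintype Y] {N L : ℕ}
    (P : (Fin N → Y) × (Fin L → Y) → ℝ) (z : Fin N → Y) : ℝ :=
  ∑ w : Fin L → Y, P (z, w)

/-- Conditional probability `P(y^L | y^N) = P(y^{N+L}) / P(y^N)`. -/
def condNL {Y : Type*} [Fintype Y] {N L : ℕ}
    (P : (Fin N → Y) × (Fin L → Y) → ℝ) (y : (Fin N → Y) × (Fin L → Y)) : ℝ :=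
  P y / margNL P y.1

/-- The conditional KL divergence `D_{c,N,L}(P ‖ Q)` of a model `P` from an
`L`-predictor `Q`. -/
def DcNL {Y : Type*} [Fintype Y] {N L : ℕ}
    (P : (Fin N → Y) × (Fin L → Y) → ℝ)
    (Q : (Fin N → Y) → (Fin L → Y) → ℝ) : ℝ :=
  ∑ y, P y * Real.log (condNL P y / Q y.1 y.2)

/-- The conditional KL divergence of a model `P` from another model `P'`. -/
def DcNLmodel {Y : Type*} [Fintype Y] {N L : ℕ}
    (P P' : (Fin N → Y) × (Fin L → Y) → ℝ) : ℝ :=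
  ∑ y, P y * Real.log (condNL P y / condNL P' y)

/-- The normalized block regret
`(1/L) Σ_{y^{N+L}} P_φ(y^{N+L}) log( P_θ(y^L|y^N) / Q(y^L|y^N) )`. -/
def regretNL {Y : Type*} [Fintype Y] {N L : ℕ}
    (Pφ Pθ : (Fin N → Y) × (Fin L → Y) → ℝ)
    (Q : (Fin N → Y) → (Fin L → Y) → ℝ) : ℝ :=
  (1 / (L : ℝ)) * ∑ y, Pφ y * Real.log (condNL Pθ y / Q y.1 y.2)

/-- Conditional divergence of a model from the hypothesis class
`Θ = {P θ : θ ∈ G}`. -/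
def DcSetNL {Y F : Type*} [Fintype Y] [Fintype F] {N L : ℕ}
    (P : F → (Fin N → Y) × (Fin L → Y) → ℝ) (G : Finset F) (hG : G.Nonempty)
    (Pφ : (Fin N → Y) × (Fin L → Y) → ℝ) : ℝ :=
  G.inf' hG fun θ => DcNLmodel Pφ (P θ)

/-- The mixture `L`-predictor
`Q_π(y^L | y^N) = (Σ_φ π(φ) P_φ(y^{N+L})) / (Σ_φ π(φ) P_φ(y^N))`. -/
def mixPredNL {Y F : Type*} [Fintype Y] [Fintype F] {N L : ℕ}
    (P : F → (Fin N → Y) × (Fin L → Y) → ℝ) (π : F → ℝ) :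
    (Fin N → Y) → (Fin L → Y) → ℝ :=
  fun z w => (∑ φ, π φ * P φ (z, w)) / (∑ φ, π φ * margNL (P φ) z)

/-- `I_π(Y^L; Φ | Y^N)`. -/
def mutualInfoNL {Y F : Type*} [Fintype Y] [Fintype F] {N L : ℕ}
    (P : F → (Fin N → Y) × (Fin L → Y) → ℝ) (π : F → ℝ) : ℝ :=
  ∑ φ, ∑ y, π φ * P φ y * Real.log (condNL (P φ) y / mixPredNL P π y.1 y.2)

/-- The combined min-max regret
`R*_{N,L}(Θ, Φ) = inf_Q max_{φ ∈ F} max_{θ ∈ G} (1/L) Σ P_φ log(P_θ(y^L|y^N)/Q(y^L|y^N))`. -/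
def RstarNL {Y F : Type*} [Fintype Y] [Fintype F] [Nonempty F] {N L : ℕ}
    (P : F → (Fin N → Y) × (Fin L → Y) → ℝ) (G : Finset F) (hG : G.Nonempty) : ℝ :=
  sInf {r : ℝ | ∃ Q, IsLPredictor Q ∧
    r = Finset.univ.sup' Finset.univ_nonempty fun φ =>
          G.sup' hG fun θ => regretNL (P φ) (P θ) Q}

theorem condNL_pos {Y : Type*} [Fintype Y] {N L : ℕ}
    {P : (Fin N → Y) × (Fin L → Y) → ℝ} (hP : ∀ y, 0 < P y)
    (y : (Fin N → Y) × (Fin L → Y)) : 0 < condNL P y :=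
  div_pos (hP y) (Finset.sum_pos (fun _ _ => hP _) ⟨y.2, Finset.mem_univ _⟩)

theorem IsPrior.sum_mul_pos {F : Type*} [Fintype F] {π : F → ℝ} (hπ : IsPrior π)
    {f : F → ℝ} (hf : ∀ φ, 0 < f φ) : 0 < ∑ φ, π φ * f φ := by
  have hne : ∃ φ ∈ Finset.univ, π φ ≠ 0 := by
    apply Finset.exists_ne_zero_of_sum_ne_zero
    rw [hπ.2]
    exact one_ne_zero
  obtain ⟨φ, -, hφ⟩ := hne
  exact Finset.sum_pos' (fun ψ _ => mul_nonneg (hπ.1 ψ) (hf ψ).le)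
    ⟨φ, Finset.mem_univ _, mul_pos (lt_of_le_of_ne (hπ.1 φ) hφ.symm) (hf φ)⟩

theorem sum_mul_margNL {Y F : Type*} [Fintype Y] [Fintype F] {N L : ℕ}
    (P : F → (Fin N → Y) × (Fin L → Y) → ℝ) (π : F → ℝ) (z : Fin N → Y) :
    ∑ φ, π φ * margNL (P φ) z = ∑ w, ∑ φ, π φ * P φ (z, w) := by
  simp only [margNL, Finset.mul_sum]
  exact Finset.sum_comm

theorem isLPredictor_mixPredNL {Y F : Type*} [Fintype Y] [Nonempty Y] [Fintype F] {N L : ℕ}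
    {P : F → (Fin N → Y) × (Fin L → Y) → ℝ} (hP : ∀ φ y, 0 < P φ y)
    {π : F → ℝ} (hπ : IsPrior π) : IsLPredictor (mixPredNL P π) := by
  intro z
  have hw : ∀ w, 0 < ∑ φ, π φ * P φ (z, w) := fun w => hπ.sum_mul_pos fun φ => hP φ _
  have hz : 0 < ∑ φ, π φ * margNL (P φ) z := by
    rw [sum_mul_margNL]
    exact Finset.sum_pos (fun w _ => hw w) Finset.univ_nonempty
  refine ⟨fun w => div_pos (hw w) hz, ?_⟩
  simp only [mixPredNL]
  rw [← Finset.sum_div, ← sum_mul_margNL, div_self hz.ne']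

/-- The mixture predictor minimizes the average conditional divergence. -/
theorem sum_mul_DcNL_mixPredNL_le {Y F : Type*} [Fintype Y] [Nonempty Y] [Fintype F] {N L : ℕ}
    {P : F → (Fin N → Y) × (Fin L → Y) → ℝ} (hP : ∀ φ y, 0 < P φ y)
    {π : F → ℝ} (hπ : IsPrior π) {Q : (Fin N → Y) → (Fin L → Y) → ℝ} (hQ : IsLPredictor Q) :
    ∑ φ, π φ * DcNL (P φ) (mixPredNL P π) ≤ ∑ φ, π φ * DcNL (P φ) Q := by
  have hmix := isLPredictor_mixPredNL hP hπ
  have hdiff : ∑ φ, π φ * DcNL (P φ) Q - ∑ φ, π φ * DcNL (P φ) (mixPredNL P π) =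
      ∑ y : (Fin N → Y) × (Fin L → Y),
        (∑ φ, π φ * P φ y) * Real.log (mixPredNL P π y.1 y.2 / Q y.1 y.2) := by
    simp only [DcNL, Finset.mul_sum, Finset.sum_mul]
    rw [← Finset.sum_sub_distrib, Finset.sum_comm]
    refine Finset.sum_congr rfl fun φ _ => ?_
    rw [← Finset.sum_sub_distrib]
    refine Finset.sum_congr rfl fun y _ => ?_
    have hc := (condNL_pos (hP φ) y).ne'
    have hm := ((hmix y.1).1 y.2).ne'
    have hq := ((hQ y.1).1 y.2).ne'
    rw [Real.log_div hc hq, Real.log_div hc hm, Real.log_div hm hq]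
    ring
  have hlower : ∑ y : (Fin N → Y) × (Fin L → Y),
      (∑ φ, π φ * margNL (P φ) y.1) * (mixPredNL P π y.1 y.2 - Q y.1 y.2) ≤
      ∑ y : (Fin N → Y) × (Fin L → Y),
        (∑ φ, π φ * P φ y) * Real.log (mixPredNL P π y.1 y.2 / Q y.1 y.2) := by
    refine Finset.sum_le_sum fun y _ => ?_
    have hm := (hmix y.1).1 y.2
    have hq := (hQ y.1).1 y.2
    have hM : 0 < ∑ φ, π φ * P φ y := hπ.sum_mul_pos fun φ => hP φ y
    have hz : 0 < ∑ φ, π φ * margNL (P φ) y.1 :=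
      hπ.sum_mul_pos fun φ =>
        Finset.sum_pos (fun _ _ => hP φ _) Finset.univ_nonempty
    have hMeq : ∑ φ, π φ * P φ y =
        (∑ φ, π φ * margNL (P φ) y.1) * mixPredNL P π y.1 y.2 := by
      simp only [mixPredNL]
      field_simp
    have hlog := Real.one_sub_inv_le_log_of_pos (div_pos hm hq)
    calc (∑ φ, π φ * margNL (P φ) y.1) * (mixPredNL P π y.1 y.2 - Q y.1 y.2)
        = (∑ φ, π φ * P φ y) * (1 - (mixPredNL P π y.1 y.2 / Q y.1 y.2)⁻¹) := by
          rw [hMeq]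
          field_simp
      _ ≤ _ := mul_le_mul_of_nonneg_left hlog hM.le
  have hzero : ∑ y : (Fin N → Y) × (Fin L → Y),
      (∑ φ, π φ * margNL (P φ) y.1) * (mixPredNL P π y.1 y.2 - Q y.1 y.2) = 0 := by
    rw [Fintype.sum_prod_type]
    refine Finset.sum_eq_zero fun z _ => ?_
    simp only
    rw [← Finset.mul_sum, Finset.sum_sub_distrib, (hmix z).2, (hQ z).2, sub_self, mul_zero]
  linarith

theorem sum_mul_sub_mixPredNL_le {Y F : Type*} [Fintype Y] [Nonempty Y] [Fintype F] {N L : ℕ}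
    {P : F → (Fin N → Y) × (Fin L → Y) → ℝ} (hP : ∀ φ y, 0 < P φ y) (d : F → ℝ)
    {π : F → ℝ} (hπ : IsPrior π) {Q : (Fin N → Y) → (Fin L → Y) → ℝ} (hQ : IsLPredictor Q) :
    ∑ φ, π φ * (DcNL (P φ) (mixPredNL P π) - d φ) ≤ ∑ φ, π φ * (DcNL (P φ) Q - d φ) := by
  simp only [mul_sub, Finset.sum_sub_distrib]
  exact sub_le_sub_right (sum_mul_DcNL_mixPredNL_le hP hπ hQ) _

theorem continuousOn_DcNL_mixPredNL {Y F : Type*} [Fintype Y] [Nonempty Y] [Fintype F] {N L : ℕ}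
    {P : F → (Fin N → Y) × (Fin L → Y) → ℝ} (hP : ∀ φ y, 0 < P φ y) (φ : F) :
    ContinuousOn (fun π => DcNL (P φ) (mixPredNL P π)) {π | IsPrior π} := by
  unfold DcNL
  refine continuousOn_finsetSum _ fun y _ => continuousOn_const.mul ?_
  have hmix : ContinuousOn (fun π => mixPredNL P π y.1 y.2) {π | IsPrior π} := by
    unfold mixPredNL
    refine ContinuousOn.div (by fun_prop) (by fun_prop) fun π hπ => ?_
    exact (hπ.sum_mul_pos fun φ =>
      Finset.sum_pos (fun _ _ => hP φ _) Finset.univ_nonempty).ne'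
  have hpos : ∀ π ∈ {π : F → ℝ | IsPrior π}, 0 < mixPredNL P π y.1 y.2 :=
    fun π hπ => (isLPredictor_mixPredNL hP hπ y.1).1 y.2
  exact (continuousOn_const.div hmix fun π hπ => (hpos π hπ).ne').log
    fun π hπ => (div_pos (condNL_pos (hP φ) y) (hpos π hπ)).ne'

/-- A maximizing prior equalizes: no model has a larger excess divergence from its mixture
predictor than the average. -/
theorem exists_isPrior_forall_DcNL_sub_le {Y F : Type*} [Fintype Y] [Nonempty Y] [Fintype F]
    [Nonempty F] {N L : ℕ}
    {P : F → (Fin N → Y) × (Fin L → Y) → ℝ} (hP : ∀ φ y, 0 < P φ y) (d : F → ℝ) :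
    ∃ π, IsPrior π ∧ ∀ φ, DcNL (P φ) (mixPredNL P π) - d φ ≤
      ∑ ψ, π ψ * (DcNL (P ψ) (mixPredNL P π) - d ψ) := by
  classical
  have hcompact : IsCompact {π : F → ℝ | IsPrior π} := isCompact_stdSimplex ℝ F
  have hsingle : ∀ φ : F, IsPrior (Pi.single φ (1 : ℝ)) := fun φ => single_mem_stdSimplex ℝ φ
  have hcont : ContinuousOn (fun π => ∑ ψ, π ψ * (DcNL (P ψ) (mixPredNL P π) - d ψ))
      {π : F → ℝ | IsPrior π} :=
    continuousOn_finsetSum _ fun ψ _ => (continuous_apply ψ).continuousOn.mul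
      ((continuousOn_DcNL_mixPredNL hP ψ).sub continuousOn_const)
  obtain ⟨π, hπ, hmax⟩ := hcompact.exists_isMaxOn
    ⟨_, hsingle (Classical.arbitrary F)⟩ hcont
  have hπ' : IsPrior π := hπ
  refine ⟨π, hπ, fun φ => ?_⟩
  let path : ℝ → F → ℝ := fun t => (1 - t) • π + t • Pi.single φ 1
  have hpath : ∀ t ∈ Set.Icc (0 : ℝ) 1, IsPrior (path t) := fun t ht =>
    convex_stdSimplex ℝ F hπ (hsingle φ) (by linarith [ht.2]) ht.1 (by ring)
  have hpath0 : path 0 = π := by simp [path]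
  have hbound : ∀ t ∈ Set.Ioc (0 : ℝ) 1, DcNL (P φ) (mixPredNL P (path t)) - d φ ≤
      ∑ ψ, π ψ * (DcNL (P ψ) (mixPredNL P π) - d ψ) := by
    intro t ht
    have hprior := hpath t ⟨ht.1.le, ht.2⟩
    have hle := hmax (show path t ∈ {π : F → ℝ | IsPrior π} from hprior)
    have hexpand : ∀ g : F → ℝ, ∑ ψ, path t ψ * g ψ = (1 - t) * ∑ ψ, π ψ * g ψ + t * g φ := by
      intro g
      simp [path, add_mul, Finset.sum_add_distrib, Finset.mul_sum, mul_assoc, Pi.single_apply]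
    have hcomp := sum_mul_sub_mixPredNL_le hP d hπ' (isLPredictor_mixPredNL hP hprior)
    simp only [Set.mem_ofPred_eq] at hle
    rw [hexpand fun ψ => DcNL (P ψ) (mixPredNL P (path t)) - d ψ] at hle
    have hcomp' := mul_le_mul_of_nonneg_left hcomp (show 0 ≤ 1 - t by linarith [ht.2])
    refine le_of_mul_le_mul_left ?_ ht.1
    linarith
  have hcontpath : ContinuousOn (fun t => DcNL (P φ) (mixPredNL P (path t)) - d φ)
      (Set.Icc 0 1) :=
    ((continuousOn_DcNL_mixPredNL hP φ).comp
      (show Continuous path by fun_prop).continuousOn hpath).sub continuousOn_const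
  have hlim := (hcontpath 0 ⟨le_rfl, zero_le_one⟩).mono_left
    (nhdsWithin_mono (0 : ℝ) Set.Ioc_subset_Icc_self)
  simp only [hpath0] at hlim
  have hne : (nhdsWithin (0 : ℝ) (Set.Ioc 0 1)).NeBot := by
    rw [nhdsWithin_Ioc_eq_nhdsGT zero_lt_one]
    infer_instance
  exact le_of_tendsto hlim (eventually_nhdsWithin_of_forall hbound)

theorem regretNL_eq {Y : Type*} [Fintype Y] {N L : ℕ}
    {P P' : (Fin N → Y) × (Fin L → Y) → ℝ} (hP : ∀ y, 0 < P y) (hP' : ∀ y, 0 < P' y)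
    {Q : (Fin N → Y) → (Fin L → Y) → ℝ} (hQ : IsLPredictor Q) :
    regretNL P P' Q = (1 / (L : ℝ)) * (DcNL P Q - DcNLmodel P P') := by
  unfold regretNL DcNL DcNLmodel
  rw [← Finset.sum_sub_distrib]
  congr 1
  refine Finset.sum_congr rfl fun y _ => ?_
  have hc := (condNL_pos hP y).ne'
  have hc' := (condNL_pos hP' y).ne'
  have hq := ((hQ y.1).1 y.2).ne'
  rw [Real.log_div hc' hq, Real.log_div hc hq, Real.log_div hc hc']
  ring

theorem sup'_regretNL {Y F : Type*} [Fintype Y] [Fintype F] {N L : ℕ}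
    {P : F → (Fin N → Y) × (Fin L → Y) → ℝ} (hP : ∀ φ y, 0 < P φ y)
    (G : Finset F) (hG : G.Nonempty) {Q : (Fin N → Y) → (Fin L → Y) → ℝ}
    (hQ : IsLPredictor Q) (φ : F) :
    G.sup' hG (fun θ => regretNL (P φ) (P θ) Q) =
      (1 / (L : ℝ)) * (DcNL (P φ) Q - DcSetNL P G hG (P φ)) := by
  apply le_antisymm
  · refine Finset.sup'_le _ _ fun θ hθ => ?_
    rw [regretNL_eq (hP φ) (hP θ) hQ]
    refine mul_le_mul_of_nonneg_left (sub_le_sub_left ?_ _) (by positivity)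
    exact Finset.inf'_le _ hθ
  · obtain ⟨θ, hθ, h⟩ := Finset.exists_mem_eq_inf' hG fun θ => DcNLmodel (P φ) (P θ)
    rw [DcSetNL, h, ← regretNL_eq (hP φ) (hP θ) hQ]
    exact Finset.le_sup' (fun θ => regretNL (P φ) (P θ) Q) hθ

theorem mutualInfoNL_sub_eq {Y F : Type*} [Fintype Y] [Fintype F] {N L : ℕ}
    (P : F → (Fin N → Y) × (Fin L → Y) → ℝ) (π d : F → ℝ) :
    mutualInfoNL P π - ∑ φ, π φ * d φ = ∑ φ, π φ * (DcNL (P φ) (mixPredNL P π) - d φ) := by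
  simp only [mutualInfoNL, DcNL, mul_sub, Finset.sum_sub_distrib, Finset.mul_sum, mul_assoc]

/-- Weak duality between priors and predictors. -/
theorem mutualInfoNL_sub_le_sup' {Y F : Type*} [Fintype Y] [Nonempty Y] [Fintype F] [Nonempty F]
    {N L : ℕ} {P : F → (Fin N → Y) × (Fin L → Y) → ℝ} (hP : ∀ φ y, 0 < P φ y)
    (G : Finset F) (hG : G.Nonempty) {π : F → ℝ} (hπ : IsPrior π)
    {Q : (Fin N → Y) → (Fin L → Y) → ℝ} (hQ : IsLPredictor Q) :
    (1 / (L : ℝ)) * (mutualInfoNL P π - ∑ φ, π φ * DcSetNL P G hG (P φ)) ≤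
      Finset.univ.sup' Finset.univ_nonempty fun φ =>
        G.sup' hG fun θ => regretNL (P φ) (P θ) Q := by
  simp only [sup'_regretNL hP G hG hQ]
  set M := Finset.univ.sup' Finset.univ_nonempty fun φ =>
    (1 / (L : ℝ)) * (DcNL (P φ) Q - DcSetNL P G hG (P φ))
  calc (1 / (L : ℝ)) * (mutualInfoNL P π - ∑ φ, π φ * DcSetNL P G hG (P φ))
      ≤ (1 / (L : ℝ)) * ∑ φ, π φ * (DcNL (P φ) Q - DcSetNL P G hG (P φ)) := by
        rw [mutualInfoNL_sub_eq P π fun φ => DcSetNL P G hG (P φ)]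
        exact mul_le_mul_of_nonneg_left (sum_mul_sub_mixPredNL_le hP _ hπ hQ) (by positivity)
    _ = ∑ φ, π φ * ((1 / (L : ℝ)) * (DcNL (P φ) Q - DcSetNL P G hG (P φ))) := by
        rw [Finset.mul_sum]
        exact Finset.sum_congr rfl fun φ _ => by ring
    _ ≤ ∑ φ, π φ * M := Finset.sum_le_sum fun φ _ => mul_le_mul_of_nonneg_left
        (Finset.le_sup' (fun φ => (1 / (L : ℝ)) * (DcNL (P φ) Q - DcSetNL P G hG (P φ)))
          (Finset.mem_univ φ)) (hπ.1 φ)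
    _ = M := by rw [← Finset.sum_mul, hπ.2, one_mul]

variable {Y F : Type*} [Fintype Y] [Nonempty Y] [Fintype F] [Nonempty F] {N L : ℕ}

/-- Theorem 4: the combined batch-and-online min-max regret
equals the maximum over priors of
`(1/L) (I_π(Y^L; Φ | Y^N) − Σ_φ π(φ) D_{c,N,L}(P_φ ‖ Θ))`; moreover, for each
prior `π`, the infimum over `L`-predictors of
`Σ_φ π(φ) (D_{c,N,L}(P_φ ‖ Q) − D_{c,N,L}(P_φ ‖ Θ))` is attained at the
mixture `L`-predictor `Q_π`. -/
theorem combined_minmax_regret_eq_max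
    (hL : 0 < L)
    (P : F → (Fin N → Y) × (Fin L → Y) → ℝ) (hP : ∀ φ, IsModelNL (P φ))
    (G : Finset F) (hG : G.Nonempty) :
    IsGreatest {r : ℝ | ∃ π, IsPrior π ∧
        r = (1 / (L : ℝ)) *
          (mutualInfoNL P π - ∑ φ, π φ * DcSetNL P G hG (P φ))}
      (RstarNL P G hG) ∧
    ∀ π, IsPrior π →
      IsLeast {r : ℝ | ∃ Q, IsLPredictor Q ∧
          r = ∑ φ, π φ * (DcNL (P φ) Q - DcSetNL P G hG (P φ))}
        (∑ φ, π φ * (DcNL (P φ) (mixPredNL P π) - DcSetNL P G hG (P φ))) := by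
  have hpos : ∀ φ y, 0 < P φ y := fun φ => (hP φ).1
  refine ⟨?_, fun π hπ => ⟨⟨_, isLPredictor_mixPredNL hpos hπ, rfl⟩, ?_⟩⟩
  · obtain ⟨π, hπ, hmax⟩ :=
      exists_isPrior_forall_DcNL_sub_le hpos fun φ => DcSetNL P G hG (P φ)
    have hmix := isLPredictor_mixPredNL hpos hπ
    have hleast : IsLeast {r : ℝ | ∃ Q, IsLPredictor Q ∧
        r = Finset.univ.sup' Finset.univ_nonempty fun φ =>
          G.sup' hG fun θ => regretNL (P φ) (P θ) Q}
        ((1 / (L : ℝ)) * (mutualInfoNL P π - ∑ φ, π φ * DcSetNL P G hG (P φ))) := by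
      refine ⟨⟨_, hmix, le_antisymm (mutualInfoNL_sub_le_sup' hpos G hG hπ hmix) ?_⟩, ?_⟩
      · refine Finset.sup'_le _ _ fun φ _ => ?_
        rw [sup'_regretNL hpos G hG hmix, mutualInfoNL_sub_eq P π fun φ => DcSetNL P G hG (P φ)]
        exact mul_le_mul_of_nonneg_left (hmax φ) (by positivity)
      · rintro _ ⟨Q, hQ, rfl⟩
        exact mutualInfoNL_sub_le_sup' hpos G hG hπ hQ
    have hR : RstarNL P G hG = _ := hleast.csInf_eq
    refine ⟨⟨π, hπ, hR⟩, ?_⟩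
    rintro _ ⟨π', hπ', rfl⟩
    rw [hR]
    obtain ⟨Q, hQ, hval⟩ := hleast.1
    rw [hval]
    exact mutualInfoNL_sub_le_sup' hpos G hG hπ' hQ
  · rintro _ ⟨Q, hQ, rfl⟩
    exact sum_mul_sub_mixPredNL_le hpos _ hπ hQ
end
end
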